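/- For a continuous action of a countable discrete group G on a compact metrizable space X, the following are equivalent: (i) for any non-empty open sets A, B, if (n+1)A ≺ nB for some n ∈ ℕ⁺ then A ≺ B; (ii) the action has generalized dynamical comparison: whenever A, B are open with A ⊆ G·B and μ(A) < 1 for every μ ∈ Pr_G(X) with μ(B) = 1, then A ≺ B. -/

import Mathlib

open scoped Pointwise NNReal ENNReal

variable {X : Type*} [TopologicalSpace X] {G : Type*} [Group G] [MulAction G X]

/-- The open support of a continuous `ℝ≥0`-valued function. -/
def osupp (f : C(X, ℝ≥0)) : Set X := {x | f x ≠ 0}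

/-- Dynamical subequivalence `A ≼ B` for two finite tuples (lists) of subsets of `X`. -/
def SetSubeq (G : Type*) [Group G] [MulAction G X] (A B : List (Set X)) : Prop :=
  ∀ F : Fin A.length → Set X,
    (∀ i, IsClosed (F i) ∧ F i ⊆ A.get i) →
    ∃ (J : Fin A.length → ℕ)
      (U : (i : Fin A.length) → Fin (J i) → Set X)
      (s : (i : Fin A.length) → Fin (J i) → G)
      (k : (i : Fin A.length) → Fin (J i) → Fin B.length),
      (∀ i j, IsOpen (U i j)) ∧
      (∀ i, F i ⊆ ⋃ j, U i j) ∧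
      (∀ i j, (s i j) • U i j ⊆ B.get (k i j)) ∧
      (∀ (p q : Σ i : Fin A.length, Fin (J i)), p ≠ q → k p.1 p.2 = k q.1 q.2 →
        Disjoint ((s p.1 p.2) • U p.1 p.2) ((s q.1 q.2) • U q.1 q.2))

/-- Dynamical subequivalence `a ≼ b` for tuples of nonnegative continuous functions. -/
def DynSubeq (G : Type*) [Group G] [MulAction G X] (a b : List C(X, ℝ≥0)) : Prop :=
  SetSubeq G (a.map osupp) (b.map osupp)

/-- The entrywise cut-down `(f - ε)₊`. -/
noncomputable def cutFun (f : C(X, ℝ≥0)) (ε : ℝ≥0) : C(X, ℝ≥0) :=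
  ⟨fun x => f x - ε, f.continuous.sub continuous_const⟩

noncomputable def cutList (a : List C(X, ℝ≥0)) (ε : ℝ≥0) : List C(X, ℝ≥0) := a.map (cutFun · ε)

/-- Membership in the algebra of sets generated by the open sets of `X`. -/
def InAlg (X : Type*) [TopologicalSpace X] (s : Set X) : Prop :=
  s ∈ MeasureTheory.generateSetAlgebra {t : Set X | IsOpen t}

/-- A `G`-invariant regular premeasure on the algebra generated by the open sets. -/
structure InvRegPremeasure (X : Type*) [TopologicalSpace X] (G : Type*) [Group G]
    [MulAction G X] where
  m : Set X → ℝ≥0∞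
  junk : ∀ s : Set X, ¬ InAlg X s → m s = 0
  empty' : m ∅ = 0
  countably_additive : ∀ A : ℕ → Set X, (∀ n, InAlg X (A n)) →
    Pairwise (Function.onFun Disjoint A) → InAlg X (⋃ n, A n) →
    m (⋃ n, A n) = ∑' n, m (A n)
  invariant : ∀ (g : G) (s : Set X), InAlg X s → m (g • s) = m s
  inner_regular : ∀ s : Set X, InAlg X s →
    m s = ⨆ (F : Set X) (_ : IsCompact F ∧ F ⊆ s), m F
  outer_regular : ∀ s : Set X, InAlg X s →
    m s = ⨅ (O : Set X) (_ : IsOpen O ∧ s ⊆ O), m O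

/-- A state on the generalized type semigroup `W(X, G)`, described at the level of
`K(X, G)`: a function on tuples which is monotone for `≼`, additive for concatenation,
and vanishes on the empty tuple. -/
structure DynState (X : Type*) [TopologicalSpace X] (G : Type*) [Group G]
    [MulAction G X] where
  toFun : List C(X, ℝ≥0) → ℝ≥0∞
  mono : ∀ a b, DynSubeq G a b → toFun a ≤ toFun b
  additive : ∀ a b, toFun (a ++ b) = toFun a + toFun b
  zero' : toFun [] = 0

/-- Lower semicontinuity of a state. -/
def DynState.LSC (D : DynState X G) : Prop :=
  ∀ a, D.toFun a = ⨆ (ε : ℝ≥0) (_ : 0 < ε), D.toFun (cutList a ε)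

theorem AddSubmonoid.exists_total_ge {K : Type*} [AddCommGroup K] (P : AddSubmonoid K) (e : K)
    (hP : ∀ n : ℕ, 0 < n → -(n • e) ∉ P) :
    ∃ Q : AddSubmonoid K, P ≤ Q ∧ (∀ n : ℕ, 0 < n → -(n • e) ∉ Q) ∧ ∀ x, x ∈ Q ∨ -x ∈ Q := by
  obtain ⟨Q, hPQ, hQ⟩ := zorn_le_nonempty₀
    {Q : AddSubmonoid K | ∀ n : ℕ, 0 < n → -(n • e) ∉ Q} (by
      intro c hc hchain y hy
      refine ⟨sSup c, ?_, fun z hz => le_sSup hz⟩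
      intro n hn hmem
      rw [AddSubmonoid.mem_sSup_of_directedOn ⟨y, hy⟩ hchain.directedOn] at hmem
      obtain ⟨Q, hQ, hQn⟩ := hmem
      exact hc hQ n hn hQn) P hP
  refine ⟨Q, hPQ, hQ.prop, ?_⟩
  have key : ∀ x, x ∉ Q → ∃ n : ℕ, 0 < n ∧ ∃ k : ℕ, ∃ p ∈ Q, p + k • x = -(n • e) := by
    intro x hx
    by_contra! hcon
    have hmem : Q ⊔ AddSubmonoid.multiples x ∈
        {Q : AddSubmonoid K | ∀ n : ℕ, 0 < n → -(n • e) ∉ Q} := by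
      intro n hn hmem
      obtain ⟨p, hp, z, ⟨k, rfl⟩, hz⟩ := AddSubmonoid.mem_sup.1 hmem
      exact hcon n hn k p hp hz
    have := hQ.le_of_ge hmem le_sup_left
    exact hx (this (AddSubmonoid.mem_sup_right (AddSubmonoid.mem_multiples x)))
  intro x
  by_contra! hx
  obtain ⟨n, hn, k, p, hp, h1⟩ := key x hx.1
  obtain ⟨m, hm, l, q, hq, h2⟩ := key (-x) hx.2
  rcases Nat.eq_zero_or_pos k with rfl | hk
  · refine hQ.prop n hn ?_
    rw [← h1]; simpa using hp
  · refine hQ.prop (l * n + k * m) (by positivity) ?_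
    have : -((l * n + k * m) • e) = l • p + k • q := by
      have h1' : p = -(n • e) - k • x := by rw [← h1]; abel
      have h2' : q = -(m • e) + l • x := by rw [← h2]; simp
      rw [h1', h2']
      module
    rw [this]
    exact Q.add_mem (Q.nsmul_mem hp _) (Q.nsmul_mem hq _)

theorem AddSubmonoid.exists_normalized_hom_of_total {K : Type*} [AddCommGroup K]
    (Q : AddSubmonoid K) (e : K) (hQ : ∀ n : ℕ, 0 < n → -(n • e) ∉ Q)
    (htot : ∀ x, x ∈ Q ∨ -x ∈ Q) (hunit : ∀ x, ∃ m : ℕ, m • e - x ∈ Q) :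
    ∃ f : K →+ ℝ, (∀ x ∈ Q, 0 ≤ f x) ∧ f e = 1 := by
  have he : ∀ k : ℤ, k • e ∈ Q → 0 ≤ k := by
    intro k hk
    by_contra! hneg
    refine hQ k.natAbs (by omega) ?_
    have : -(k.natAbs • e) = k • e := by
      rw [← natCast_zsmul, ← neg_zsmul]; congr 1; omega
    rwa [this]
  have heQ : e ∈ Q := by
    rcases htot e with h | h
    · exact h
    · exact absurd (by simpa using h) (hQ 1 one_pos)
  let U : K → Set ℝ := fun x => {r | ∃ (k : ℤ) (n : ℕ), 0 < n ∧ r = k / n ∧ k • e - n • x ∈ Q}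
  have hne : ∀ x, (U x).Nonempty := by
    intro x
    obtain ⟨m, hm⟩ := hunit x
    exact ⟨m, m, 1, one_pos, by simp, by simpa using hm⟩
  have hadd : ∀ x y r s, r ∈ U x → s ∈ U y → r + s ∈ U (x + y) := by
    rintro x y _ _ ⟨k, n, hn, rfl, h⟩ ⟨l, m, hm, rfl, h'⟩
    refine ⟨k * m + l * n, n * m, by positivity, ?_, ?_⟩
    · push_cast; field_simp
    · have : (k * m + l * n) • e - (n * m) • (x + y)
          = m • (k • e - n • x) + n • (l • e - m • y) := by module
      rw [this]
      exact Q.add_mem (Q.nsmul_mem h _) (Q.nsmul_mem h' _)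
  have hzero : ∀ r ∈ U 0, 0 ≤ r := by
    rintro _ ⟨k, n, hn, rfl, h⟩
    have := he k (by simpa using h)
    positivity
  have hbdd : ∀ x, BddBelow (U x) := by
    intro x
    obtain ⟨s, hs⟩ := hne (-x)
    refine ⟨-s, fun r hr => ?_⟩
    have := hzero (r + s) (by simpa using hadd x (-x) r s hr hs)
    linarith
  let f : K → ℝ := fun x => sInf (U x)
  have hsub : ∀ x y, f (x + y) ≤ f x + f y := by
    intro x y
    refine le_of_forall_pos_le_add fun ε hε => ?_
    obtain ⟨r, hr, hr'⟩ := exists_lt_of_csInf_lt (hne x) (lt_add_of_pos_right (f x) (half_pos hε))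
    obtain ⟨s, hs, hs'⟩ := exists_lt_of_csInf_lt (hne y) (lt_add_of_pos_right (f y) (half_pos hε))
    have := csInf_le (hbdd _) (hadd x y r s hr hs)
    change sInf (U (x + y)) ≤ _
    linarith
  have hneg : ∀ y, f (-y) ≤ -f y := by
    intro y
    rw [le_neg]
    refine le_of_forall_rat_lt_imp_le fun q hq => ?_
    rw [le_neg]
    have hq' : (q : ℝ) ∉ U y := fun h => (csInf_le (hbdd _) h).not_gt hq
    refine csInf_le (hbdd _) ⟨-q.num, q.den, q.pos, ?_, ?_⟩
    · conv_lhs => rw [← Rat.num_div_den q]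
      push_cast
      ring
    · have h1 : q.num • e - q.den • y ∉ Q := fun h =>
        hq' ⟨q.num, q.den, q.pos, by
          conv_lhs => rw [← Rat.num_div_den q]
          push_cast
          rfl, h⟩
      have := (htot (q.num • e - q.den • y)).resolve_left h1
      convert this using 1
      module
  refine ⟨AddMonoidHom.mk' f fun x y => le_antisymm (hsub x y) ?_, ?_, ?_⟩
  · have h1 := hsub (x + y) (-y)
    have h2 := hneg y
    rw [add_neg_cancel_right] at h1
    linarith
  · intro x hx
    refine le_csInf (hne x) ?_
    rintro _ ⟨k, n, hn, rfl, h⟩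
    have := he k (by simpa using Q.add_mem h (Q.nsmul_mem hx n))
    positivity
  · refine le_antisymm (csInf_le (hbdd _) ⟨1, 1, one_pos, by simp, by simp⟩) (le_csInf (hne e) ?_)
    rintro _ ⟨k, n, hn, rfl, h⟩
    have := he (k - n) (by simpa [sub_smul] using h)
    rw [one_le_div (by positivity)]
    exact_mod_cast (by omega : (n : ℤ) ≤ k)

section OrderedMonoid

variable {M : Type*} [AddCommMonoid M] [Preorder M] [IsOrderedAddMonoid M]

theorem add_nsmul_le_add_nsmul_of_add_le_add {b x y : M} (h : b + x ≤ b + y) (j : ℕ) :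
    b + j • x ≤ b + j • y := by
  induction j with
  | zero => simp
  | succ j ih =>
    calc b + (j + 1) • x = (b + j • x) + x := by rw [succ_nsmul, add_assoc]
      _ ≤ (b + j • y) + x := by gcongr
      _ = (b + x) + j • y := by abel
      _ ≤ (b + y) + j • y := by gcongr
      _ = b + (j + 1) • y := by rw [succ_nsmul]; abel

theorem exists_succ_nsmul_le_nsmul (h0 : ∀ x : M, 0 ≤ x) {e a b : M} {r n m l : ℕ} (hn : 0 < n)
    (hb : b ≤ m • e) (ha : a ≤ l • e) (h : b + (r • a + n • e) ≤ b + r • e) :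
    ∃ N : ℕ, 0 < N ∧ (N + 1) • a ≤ N • e := by
  have hmono : ∀ {k k' : ℕ} (x : M), k ≤ k' → k • x ≤ k' • x := fun {k k'} x hk => by
    obtain ⟨d, rfl⟩ := Nat.exists_eq_add_of_le hk
    rw [add_nsmul]
    exact le_add_of_nonneg_right (h0 _)
  let j := l * (m + 2)
  refine ⟨j * r + (m + 1), by omega, ?_⟩
  calc (j * r + (m + 1) + 1) • a = (j * r) • a + (m + 2) • a := by rw [← add_nsmul, add_assoc]
    _ ≤ (j * r) • a + (m + 2) • (l • e) := by gcongr
    _ = (j * r) • a + j • e := by rw [← mul_nsmul]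
    _ ≤ (j * r) • a + (j * n) • e :=
      add_le_add le_rfl (hmono e (Nat.le_mul_of_pos_right j hn))
    _ = j • (r • a + n • e) := by simp only [smul_add, ← mul_nsmul']
    _ ≤ b + j • (r • a + n • e) := le_add_of_nonneg_left (h0 _)
    _ ≤ b + j • (r • e) := add_nsmul_le_add_nsmul_of_add_le_add h j
    _ ≤ (m + 1) • e + j • (r • e) := by gcongr; exact hb.trans (hmono e (by omega))
    _ = (j * r + (m + 1)) • e := by rw [← mul_nsmul', ← add_nsmul, add_comm]

theorem exists_real_state (h0 : ∀ x : M, 0 ≤ x) (e a : M) (hunit : ∀ x : M, ∃ m : ℕ, x ≤ m • e)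
    (h : ∀ n : ℕ, 0 < n → ¬ (n + 1) • a ≤ n • e) :
    ∃ f : M →+ ℝ, Monotone f ∧ f e = 1 ∧ 1 ≤ f a := by
  let φ : M →+ Algebra.GrothendieckAddGroup M := Algebra.GrothendieckAddGroup.of
  have hφ : ∀ x y, φ x = φ y → ∃ u, u + x = u + y := by
    intro x y hxy
    obtain ⟨c, hc⟩ := (AddLocalization.addMonoidOf (⊤ : AddSubmonoid M)).eq_iff_exists.1 hxy
    exact ⟨c, hc⟩
  have hsurj : ∀ z, ∃ x y, z = φ x - φ y := by
    intro z
    obtain ⟨⟨x, y⟩, hxy⟩ := (AddLocalization.addMonoidOf (⊤ : AddSubmonoid M)).surj z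
    exact ⟨x, y, eq_sub_of_add_eq hxy⟩
  let P : AddSubmonoid (Algebra.GrothendieckAddGroup M) :=
    { carrier := {z | ∃ (x y : M) (r : ℕ), x ≤ y ∧ z = φ y - φ x + r • (φ a - φ e)}
      zero_mem' := ⟨0, 0, 0, le_rfl, by simp⟩
      add_mem' := by
        rintro _ _ ⟨x, y, r, hxy, rfl⟩ ⟨x', y', r', hxy', rfl⟩
        refine ⟨x + x', y + y', r + r', add_le_add hxy hxy', ?_⟩
        simp only [map_add, add_nsmul]
        abel }
  have hP : ∀ n : ℕ, 0 < n → -(n • φ e) ∉ P := by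
    rintro n hn ⟨x, y, r, hxy, hz⟩
    obtain ⟨u, hu⟩ := hφ (y + (r • a + n • e)) (x + r • e) (by
      simp only [map_add, map_nsmul]
      rw [← sub_eq_zero] at hz ⊢
      rw [← neg_eq_zero, ← hz]
      module)
    obtain ⟨m, hm⟩ := hunit (u + y)
    obtain ⟨l, hl⟩ := hunit a
    obtain ⟨N, hN, hN'⟩ := exists_succ_nsmul_le_nsmul h0 hn hm hl (r := r) (by
      rw [add_assoc, hu, ← add_assoc]
      gcongr)
    exact h N hN hN'
  obtain ⟨Q, hPQ, hQ, htot⟩ := P.exists_total_ge (φ e) hP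
  obtain ⟨f, hf, hfe⟩ := Q.exists_normalized_hom_of_total (φ e) hQ htot (by
    intro z
    obtain ⟨x, y, rfl⟩ := hsurj z
    obtain ⟨m, hm⟩ := hunit x
    refine ⟨m, hPQ ⟨x, m • e + y, 0, hm.trans (le_add_of_nonneg_right (h0 _)), ?_⟩⟩
    simp only [map_add, map_nsmul, zero_smul]
    abel)
  refine ⟨f.comp φ, fun x y hxy => ?_, hfe, ?_⟩
  · have := hf _ (hPQ ⟨x, y, 0, hxy, rfl⟩)
    simp only [zero_smul, add_zero, map_sub, sub_nonneg] at this
    exact this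
  · have := hf _ (hPQ ⟨0, 0, 1, le_rfl, rfl⟩)
    simp only [map_zero, sub_zero, one_smul, zero_add, map_sub, sub_nonneg] at this
    rw [hfe] at this
    exact this

/-- In a positively ordered monoid, if no multiple inequality `(n + 1) • a ≤ n • e` holds, then
some `[0, ∞]`-valued state is normalized at `e` and at least `1` at `a`. -/
theorem exists_ennreal_state (h0 : ∀ x : M, 0 ≤ x) (e a : M) (ha : ∃ m : ℕ, a ≤ m • e)
    (h : ∀ n : ℕ, 0 < n → ¬ (n + 1) • a ≤ n • e) :
    ∃ f : M →+ ℝ≥0∞, Monotone f ∧ f e = 1 ∧ 1 ≤ f a := by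
  classical
  let S : AddSubmonoid M :=
    { carrier := {x | ∃ m : ℕ, x ≤ m • e}
      zero_mem' := ⟨0, by simp⟩
      add_mem' := by
        rintro x y ⟨m, hm⟩ ⟨n, hn⟩
        exact ⟨m + n, by rw [add_nsmul]; exact add_le_add hm hn⟩ }
  have hS : ∀ {x y : M}, x ≤ y → y ∈ S → x ∈ S := fun hxy ⟨m, hm⟩ => ⟨m, hxy.trans hm⟩
  have heS : e ∈ S := ⟨1, by simp⟩
  obtain ⟨g, hg, hge, hga⟩ := exists_real_state (M := S) (fun x => h0 x) ⟨e, heS⟩ ⟨a, ha⟩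
    (fun ⟨x, m, hm⟩ => ⟨m, hm⟩) h
  have hg0 : ∀ x, 0 ≤ g x := fun x => by simpa using hg (show (0 : S) ≤ x from h0 x)
  let f : M → ℝ≥0∞ := fun x => if hx : x ∈ S then ENNReal.ofReal (g ⟨x, hx⟩) else ∞
  have hf : ∀ {x} (hx : x ∈ S), f x = ENNReal.ofReal (g ⟨x, hx⟩) := fun hx => dif_pos hx
  have hf' : ∀ {x}, x ∉ S → f x = ∞ := fun hx => dif_neg hx
  refine ⟨⟨⟨f, ?_⟩, fun x y => ?_⟩, fun x y hxy => ?_, ?_, ?_⟩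
  · rw [hf S.zero_mem]
    exact (congrArg ENNReal.ofReal (map_zero g)).trans ENNReal.ofReal_zero
  · change f (x + y) = f x + f y
    by_cases hx : x ∈ S
    · by_cases hy : y ∈ S
      · rw [hf hx, hf hy, hf (S.add_mem hx hy), ← ENNReal.ofReal_add (hg0 _) (hg0 _), ← map_add]
        rfl
      · rw [hf' hy, hf' fun hxy => hy (hS (le_add_of_nonneg_left (h0 x)) hxy), add_top]
    · rw [hf' hx, hf' fun hxy => hx (hS (le_add_of_nonneg_right (h0 y)) hxy), top_add]
  · change f x ≤ f y
    by_cases hy : y ∈ S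
    · rw [hf hy, hf (hS hxy hy)]
      exact ENNReal.ofReal_le_ofReal (hg hxy)
    · rw [hf' hy]
      exact le_top
  · change f e = 1
    rw [hf heS, hge, ENNReal.ofReal_one]
  · change 1 ≤ f a
    rw [hf ha]
    simpa using ENNReal.ofReal_le_ofReal hga

end OrderedMonoid

/-- Dynamical subequivalence for families of sets indexed by arbitrary types. -/
def FamSubeq (G : Type*) [Group G] [MulAction G X] {ι κ : Type} (A : ι → Set X) (B : κ → Set X) :
    Prop :=
  ∀ F : ι → Set X, (∀ i, IsClosed (F i) ∧ F i ⊆ A i) →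
    ∃ (J : Type) (_ : Finite J) (i : J → ι) (U : J → Set X) (s : J → G) (k : J → κ),
      (∀ j, IsOpen (U j)) ∧ (∀ x, F x ⊆ ⋃ (j) (_ : i j = x), U j) ∧ (∀ j, s j • U j ⊆ B (k j)) ∧
      ∀ p q, p ≠ q → k p = k q → Disjoint (s p • U p) (s q • U q)

theorem setSubeq_iff_famSubeq (A B : List (Set X)) :
    SetSubeq G A B ↔ FamSubeq G A.get B.get := by
  refine forall₂_congr fun F hF => ⟨?_, ?_⟩
  · rintro ⟨J, U, s, k, hU, hF, hB, hd⟩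
    refine ⟨Σ i, Fin (J i), inferInstance, Sigma.fst, fun p => U p.1 p.2, fun p => s p.1 p.2,
      fun p => k p.1 p.2, fun p => hU _ _, fun x y hy => ?_, fun p => hB _ _, hd⟩
    obtain ⟨j, hj⟩ := Set.mem_iUnion.1 (hF x hy)
    exact Set.mem_iUnion₂.2 ⟨⟨x, j⟩, rfl, hj⟩
  · rintro ⟨J, _, i, U, s, k, hU, hF, hB, hd⟩
    let e : ∀ x, Fin (Nat.card {j // i j = x}) ≃ {j // i j = x} := fun x =>
      (Finite.equivFin _).symm
    refine ⟨fun x => Nat.card {j // i j = x}, fun x t => U (e x t), fun x t => s (e x t),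
      fun x t => k (e x t), fun x t => hU _, fun x y hy => ?_, fun x t => hB _, ?_⟩
    · obtain ⟨j, hj, hjy⟩ := Set.mem_iUnion₂.1 (hF x hy)
      exact Set.mem_iUnion.2 ⟨(e x).symm ⟨j, hj⟩, by simpa using hjy⟩
    · rintro ⟨x, t⟩ ⟨x', t'⟩ hne hk
      refine hd _ _ (fun heq => hne ?_) hk
      change (e x t : J) = e x' t' at heq
      have hx : x = x' := by rw [← (e x t).2, ← (e x' t').2, heq]
      subst hx
      rw [(e x).injective (Subtype.ext heq)]

namespace FamSubeq

variable {ι κ τ ι' κ' : Type}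

theorem of_injective {A : ι → Set X} {B : κ → Set X} [Finite ι] (hA : ∀ i, IsOpen (A i))
    (σ : ι → κ) (hσ : σ.Injective) (h : ∀ i, A i ⊆ B (σ i)) : FamSubeq G A B := by
  intro F hF
  refine ⟨ι, inferInstance, id, A, fun _ => 1, σ, hA, fun x y hy => ?_, fun j => ?_,
    fun p q hpq hk => absurd (hσ hk) hpq⟩
  · exact Set.mem_iUnion₂.2 ⟨x, rfl, (hF x).2 hy⟩
  · simpa using h j

theorem reindex {A : ι → Set X} {B : κ → Set X} {A' : ι' → Set X} {B' : κ' → Set X}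
    (h : FamSubeq G A B) (e : ι ≃ ι') (σ : κ → κ') (hσ : σ.Injective)
    (hA : ∀ i, A' (e i) ⊆ A i) (hB : ∀ k, B k ⊆ B' (σ k)) : FamSubeq G A' B' := by
  intro F hF
  obtain ⟨J, hJ, i, U, s, k, hU, hFU, hUB, hd⟩ :=
    h (F ∘ e) fun i => ⟨(hF _).1, (hF _).2.trans (hA i)⟩
  refine ⟨J, hJ, e ∘ i, U, s, σ ∘ k, hU, fun x y hy => ?_, fun j => (hUB j).trans (hB _),
    fun p q hpq hk => hd p q hpq (hσ hk)⟩
  obtain ⟨x, rfl⟩ := e.surjective x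
  obtain ⟨j, hj, hjy⟩ := Set.mem_iUnion₂.1 (hFU x hy)
  exact Set.mem_iUnion₂.2 ⟨j, congrArg e hj, hjy⟩

theorem trans [ContinuousConstSMul G X] [NormalSpace X]
    {A : ι → Set X} {B : κ → Set X} {C : τ → Set X}
    (hAB : FamSubeq G A B) (hBC : FamSubeq G B C) : FamSubeq G A C := by
  intro F hF
  obtain ⟨J, _, i, U, s, k, hU, hFU, hB, hd⟩ := hAB F hF
  have hK : ∀ x, ∃ v : J → Set X, F x ⊆ ⋃ j, v j ∧ (∀ j, IsClosed (v j)) ∧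
      ∀ j, v j ⊆ ⋃ (_ : i j = x), U j := fun x =>
    exists_subset_iUnion_closed_subset (hF x).1 (fun j => isOpen_iUnion fun _ => hU j)
      (fun _ _ => Set.toFinite _) (hFU x)
  choose v hFv hv hvU using hK
  obtain ⟨L, _, i', V, t, k', hV, hFV, hC, hd'⟩ := hBC
    (fun l => ⋃ (j) (_ : k j = l), s j • v (i j) j) (fun l => by
      refine ⟨isClosed_iUnion_of_finite fun j => isClosed_iUnion_of_finite fun _ =>
        (hv _ _).smul _, Set.iUnion₂_subset ?_⟩
      rintro j rfl
      refine (Set.smul_set_mono ((hvU _ j).trans ?_)).trans (hB j)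
      simp)
  refine ⟨{p : J × L // i' p.2 = k p.1}, inferInstance, fun p => i p.1.1,
    fun p => U p.1.1 ∩ (s p.1.1)⁻¹ • V p.1.2, fun p => t p.1.2 * s p.1.1, fun p => k' p.1.2,
    fun p => (hU _).inter ((hV _).smul _), fun x y hy => ?_, fun p => ?_, ?_⟩
  · obtain ⟨j, hj⟩ := Set.mem_iUnion.1 (hFv x hy)
    obtain ⟨hjx, hjU⟩ := Set.mem_iUnion.1 (hvU x j hj)
    subst hjx
    have : s j • y ∈ ⋃ (j') (_ : k j' = k j), s j' • v (i j') j' :=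
      Set.mem_iUnion₂.2 ⟨j, rfl, Set.smul_mem_smul_set hj⟩
    obtain ⟨l, hl, hlV⟩ := Set.mem_iUnion₂.1 (hFV _ this)
    exact Set.mem_iUnion₂.2 ⟨⟨(j, l), hl⟩, rfl, hjU, Set.mem_inv_smul_set_iff.2 hlV⟩
  · rw [mul_smul]
    refine (Set.smul_set_mono ?_).trans (hC p.1.2)
    rw [Set.smul_set_subset_iff_subset_inv_smul_set]
    exact Set.inter_subset_right
  · rintro ⟨⟨j, l⟩, hp⟩ ⟨⟨j', l'⟩, hp'⟩ hne hk
    by_cases hl : l = l'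
    · subst hl
      have hj : j ≠ j' := by rintro rfl; exact hne rfl
      simp only [mul_smul, Set.disjoint_smul_set]
      exact (hd j j' hj (hp.symm.trans hp')).mono (Set.smul_set_mono Set.inter_subset_left)
        (Set.smul_set_mono Set.inter_subset_left)
    · refine (hd' l l' hl hk).mono ?_ ?_ <;>
      · simp only [mul_smul]
        refine Set.smul_set_mono ?_
        rw [Set.smul_set_subset_iff_subset_inv_smul_set]
        exact Set.inter_subset_right

theorem sumElim {A : ι → Set X} {B : κ → Set X} {A' : ι' → Set X} {B' : κ' → Set X}
    (h : FamSubeq G A B) (h' : FamSubeq G A' B') :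
    FamSubeq G (Sum.elim A A') (Sum.elim B B') := by
  intro F hF
  obtain ⟨J, _, i, U, s, k, hU, hFU, hB, hd⟩ := h (F ∘ Sum.inl) fun x => hF (Sum.inl x)
  obtain ⟨J', _, i', U', s', k', hU', hFU', hB', hd'⟩ := h' (F ∘ Sum.inr) fun x => hF (Sum.inr x)
  refine ⟨J ⊕ J', inferInstance, Sum.map i i', Sum.elim U U', Sum.elim s s', Sum.map k k',
    ?_, ?_, ?_, ?_⟩
  · rintro (j | j)
    exacts [hU j, hU' j]
  · rintro (x | x) y hy
    · obtain ⟨j, hj, hjy⟩ := Set.mem_iUnion₂.1 (hFU x hy)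
      exact Set.mem_iUnion₂.2 ⟨Sum.inl j, congrArg Sum.inl hj, hjy⟩
    · obtain ⟨j, hj, hjy⟩ := Set.mem_iUnion₂.1 (hFU' x hy)
      exact Set.mem_iUnion₂.2 ⟨Sum.inr j, congrArg Sum.inr hj, hjy⟩
  · rintro (j | j)
    exacts [hB j, hB' j]
  · rintro (p | p) (q | q) hne hk
    · exact hd p q (fun h => hne (congrArg _ h)) (Sum.inl_injective hk)
    · cases hk
    · cases hk
    · exact hd' p q (fun h => hne (congrArg _ h)) (Sum.inr_injective hk)

end FamSubeq

theorem setSubeq_replicate_iff (A B : Set X) (n m : ℕ) :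
    SetSubeq G (List.replicate n A) (List.replicate m B) ↔
      FamSubeq G (fun _ : Fin n => A) (fun _ : Fin m => B) := by
  rw [setSubeq_iff_famSubeq]
  exact ⟨fun h => h.reindex (finCongr (by simp)) (Fin.cast (by simp)) (Fin.cast_injective _)
      (by simp) (by simp),
    fun h => h.reindex (finCongr (by simp)) (Fin.cast (by simp)) (Fin.cast_injective _)
      (by simp) (by simp)⟩

/-- Finite multisets of open sets, preordered by dynamical subequivalence. -/
def OpenMultiset (X : Type*) [TopologicalSpace X] (_G : Type*) : Type _ :=
  Multiset (TopologicalSpace.Opens X)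

namespace OpenMultiset

open TopologicalSpace

instance : AddCommMonoid (OpenMultiset X G) :=
  inferInstanceAs (AddCommMonoid (Multiset (Opens X)))

/-- The family of open sets listed by `l`. -/
def family (l : List (Opens X)) : Fin l.length → Set X := fun i => l.get i

theorem isOpen_family (l : List (Opens X)) (i : Fin l.length) : IsOpen (family l i) :=
  (l.get i).isOpen

theorem famSubeq_append_sumElim (l l' : List (Opens X)) :
    FamSubeq G (family (l ++ l')) (Sum.elim (family l) (family l')) := by
  refine .of_injective (isOpen_family _)
    (finSumFinEquiv.symm ∘ Fin.cast List.length_append)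
    (finSumFinEquiv.symm.injective.comp (Fin.cast_injective _)) fun i => ?_
  obtain ⟨j, rfl⟩ := (finCongr (List.length_append (as := l) (bs := l')).symm).surjective i
  obtain ⟨j, rfl⟩ := finSumFinEquiv.surjective j
  rcases j with j | j <;> simp [family]

theorem famSubeq_sumElim_append (l l' : List (Opens X)) :
    FamSubeq G (Sum.elim (family l) (family l')) (family (l ++ l')) := by
  refine .of_injective ?_ (Fin.cast List.length_append.symm ∘ finSumFinEquiv)
    ((Fin.cast_injective _).comp finSumFinEquiv.injective) ?_
  · rintro (i | i) <;> exact isOpen_family _ _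
  · rintro (j | j) <;> simp [family]

theorem famSubeq_refl (l : List (Opens X)) : FamSubeq G (family l) (family l) :=
  .of_injective (isOpen_family l) id Function.injective_id fun _ => le_rfl

/-- The multiset consisting of one open set. -/
def single (G : Type*) (U : Opens X) : OpenMultiset X G :=
  (([U] : List (Opens X)) : Multiset (Opens X))

theorem nsmul_single {X : Type*} [TopologicalSpace X] {G : Type*} (n : ℕ) (U : Opens X) :
    n • single G U =
      (show OpenMultiset X G from ((List.replicate n U : List _) : Multiset (Opens X))) :=
  (Multiset.nsmul_singleton U n).trans (Multiset.coe_replicate n U).symm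

variable [ContinuousConstSMul G X] [NormalSpace X]

theorem famSubeq_append {a b a' b' : List (Opens X)} (h : FamSubeq G (family a) (family b))
    (h' : FamSubeq G (family a') (family b')) :
    FamSubeq G (family (a ++ a')) (family (b ++ b')) :=
  ((famSubeq_append_sumElim a a').trans (h.sumElim h')).trans (famSubeq_sumElim_append b b')

theorem famSubeq_of_perm {l l' : List (Opens X)} (h : l.Perm l') :
    FamSubeq G (family l) (family l') := by
  induction h with
  | nil => exact famSubeq_refl _
  | cons x _ ih => exact famSubeq_append (famSubeq_refl [x]) ih
  | swap x y l =>
    refine famSubeq_append (a := [y, x]) (b := [x, y]) ?_ (famSubeq_refl l)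
    refine .of_injective (isOpen_family _) (Equiv.swap (0 : Fin 2) 1) (Equiv.injective _) fun i => ?_
    fin_cases i <;> simp [family]
  | trans _ _ ih ih' => exact ih.trans ih'

noncomputable instance : Preorder (OpenMultiset X G) where
  le a b := FamSubeq G (family (Multiset.toList a)) (family (Multiset.toList b))
  le_refl a := famSubeq_refl _
  le_trans _ _ _ h h' := h.trans h'

theorem coe_le_coe {l l' : List (Opens X)} :
    (show OpenMultiset X G from (l : Multiset (Opens X))) ≤
      (show OpenMultiset X G from (l' : Multiset (Opens X))) ↔
      FamSubeq G (family l) (family l') := by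
  have h : ∀ l : List (Opens X), (l : Multiset (Opens X)).toList.Perm l := fun l =>
    Multiset.coe_eq_coe.1 (Multiset.coe_toList _)
  exact ⟨fun H => ((famSubeq_of_perm (h l).symm).trans H).trans (famSubeq_of_perm (h l')),
    fun H => ((famSubeq_of_perm (h l)).trans H).trans (famSubeq_of_perm (h l').symm)⟩

theorem zero_le' (a : OpenMultiset X G) : 0 ≤ a := by
  induction a using Quotient.inductionOn with | _ l =>
  exact coe_le_coe (l := []).2
    (.of_injective (isOpen_family _) Fin.elim0 (fun i => i.elim0) (fun i => i.elim0))

instance : IsOrderedAddMonoid (OpenMultiset X G) where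
  add_le_add_left a b h c := by
    induction a using Quotient.inductionOn with | _ a =>
    induction b using Quotient.inductionOn with | _ b =>
    induction c using Quotient.inductionOn with | _ c =>
    exact coe_le_coe.2 (famSubeq_append (coe_le_coe.1 h) (famSubeq_refl c))

theorem nsmul_single_le_iff (n m : ℕ) (U V : Opens X) :
    n • single G U ≤ m • single G V ↔
      FamSubeq G (fun _ : Fin n => (U : Set X)) (fun _ : Fin m => (V : Set X)) := by
  rw [nsmul_single, nsmul_single, coe_le_coe]
  exact ⟨fun h => h.reindex (finCongr (by simp)) (Fin.cast (by simp)) (Fin.cast_injective _)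
      (by simp [family]) (by simp [family]),
    fun h => h.reindex (finCongr (by simp)) (Fin.cast (by simp)) (Fin.cast_injective _)
      (by simp [family]) (by simp [family])⟩

theorem single_mono : Monotone (single G : Opens X → OpenMultiset X G) := fun U V h =>
  coe_le_coe.2 (.of_injective (isOpen_family _) id Function.injective_id
    (by simpa [family] using h))

theorem single_le_of_eq_smul {g : G} {U V : Opens X} (h : (V : Set X) = g • (U : Set X)) :
    single G V ≤ single G U := by
  refine coe_le_coe.2 fun F hF => ⟨Fin 1, inferInstance, id, fun _ => V, fun _ => g⁻¹, id,
    fun _ => V.isOpen, fun x y hy => ?_, fun j => ?_, fun p q hpq hk => absurd hk hpq⟩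
  · exact Set.mem_iUnion₂.2 ⟨x, rfl, by simpa [family] using (hF x).2 hy⟩
  · simp [family, h]

theorem single_bot_le : single G (⊥ : Opens X) ≤ 0 := by
  refine coe_le_coe (l' := []).2 fun F hF => ⟨Empty, inferInstance, nofun, nofun, nofun, nofun,
    nofun, fun x y hy => ?_, nofun, nofun⟩
  simpa [family] using (hF x).2 hy

theorem single_sup_le (U V : Opens X) : single G (U ⊔ V) ≤ single G U + single G V := by
  refine coe_le_coe (l := [U ⊔ V]) (l' := [U, V]).2 fun F hF => ⟨Fin 2, inferInstance, fun _ => 0,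
    family [U, V], fun _ => 1, id, isOpen_family [U, V], fun x y hy => ?_, fun j => ?_,
    fun p q hpq hk => absurd hk hpq⟩
  · have hx : (0 : Fin 1) = x := Subsingleton.elim _ _
    have : y ∈ (U : Set X) ∪ V := by simpa [family] using (hF x).2 hy
    rcases this with h | h
    · exact Set.mem_iUnion₂.2 ⟨0, hx, h⟩
    · exact Set.mem_iUnion₂.2 ⟨1, hx, h⟩
  · rw [one_smul]
    rfl

theorem single_add_le {U V : Opens X} (h : Disjoint U V) :
    single G U + single G V ≤ single G (U ⊔ V) := by
  rw [← Opens.coe_disjoint] at h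
  refine coe_le_coe (l := [U, V]) (l' := [U ⊔ V]).2 fun F hF => ⟨Fin 2, inferInstance, id,
    family [U, V], fun _ => 1, fun _ => 0, isOpen_family [U, V], fun x y hy => ?_, fun j => ?_,
    fun p q hpq _ => ?_⟩
  · exact Set.mem_iUnion₂.2 ⟨x, rfl, (hF x).2 hy⟩
  · rw [one_smul]
    fin_cases j
    exacts [Set.subset_union_left, Set.subset_union_right]
  · simp only [one_smul]
    fin_cases p <;> fin_cases q
    exacts [absurd rfl hpq, h, h.symm, absurd rfl hpq]

end OpenMultiset

section Measure

open TopologicalSpace MeasureTheory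

/-- The inner regularization of a set function defined on open sets. -/
noncomputable def innerReg (D : Opens X → ℝ≥0∞) (U : Set X) : ℝ≥0∞ :=
  ⨆ (V : Opens X) (_ : closure (V : Set X) ⊆ U), D V

theorem innerReg_mono (D : Opens X → ℝ≥0∞) {U U' : Set X} (h : U ⊆ U') :
    innerReg D U ≤ innerReg D U' :=
  iSup₂_le fun V hV => le_iSup₂_of_le V (hV.trans h) le_rfl

theorem innerReg_empty {D : Opens X → ℝ≥0∞} (h0 : D ⊥ = 0) : innerReg D ∅ = 0 := by
  refine le_antisymm (iSup₂_le fun V hV => ?_) zero_le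
  have : V = ⊥ := Opens.ext (Set.subset_empty_iff.1 (subset_closure.trans hV))
  rw [this, h0]

theorem innerReg_iUnion_le [CompactSpace X] [NormalSpace X] {D : Opens X → ℝ≥0∞} (h0 : D ⊥ = 0)
    (hmono : Monotone D) (hsub : ∀ U V, D (U ⊔ V) ≤ D U + D V) (U : ℕ → Set X)
    (hU : ∀ n, IsOpen (U n)) : innerReg D (⋃ n, U n) ≤ ∑' n, innerReg D (U n) := by
  refine iSup₂_le fun V hV => ?_
  obtain ⟨t, ht⟩ := isClosed_closure.isCompact.elim_finite_subcover U hU hV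
  have ht' : closure (V : Set X) ⊆ ⋃ n : t, U n := ht.trans (by simp [Set.iUnion_subtype])
  obtain ⟨v, hVv, hv, hvU⟩ := exists_subset_iUnion_closure_subset isClosed_closure
    (fun n : t => hU n) (fun _ _ => Set.toFinite _) ht'
  let W : t → Opens X := fun n => ⟨v n, hv n⟩
  have hfin : ∀ s : Finset t, D (s.sup W) ≤ ∑ n ∈ s, D (W n) := fun s => by
    classical
    induction s using Finset.induction_on with
    | empty => simp [h0]
    | insert a s ha ih =>
      rw [Finset.sup_insert, Finset.sum_insert ha]
      exact (hsub _ _).trans (add_le_add le_rfl ih)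
  calc D V ≤ D (Finset.univ.sup W) := hmono fun x hx => by
        obtain ⟨n, hn⟩ := Set.mem_iUnion.1 (hVv (subset_closure hx))
        exact (Finset.le_sup (f := W) (Finset.mem_univ n)) hn
    _ ≤ ∑ n : t, D (W n) := hfin _
    _ ≤ ∑ n : t, innerReg D (U n) := Finset.sum_le_sum fun n _ => le_iSup₂_of_le (W n) (hvU n) le_rfl
    _ = ∑ n ∈ t, innerReg D (U n) := Finset.sum_coe_sort t fun n => innerReg D (U n)
    _ ≤ ∑' n, innerReg D (U n) := ENNReal.sum_le_tsum t

theorem innerReg_add_le {D : Opens X → ℝ≥0∞}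
    (hsuper : ∀ U V, Disjoint U V → D U + D V ≤ D (U ⊔ V)) {U U' : Set X} (h : Disjoint U U') :
    innerReg D U + innerReg D U' ≤ innerReg D (U ∪ U') := by
  refine ENNReal.biSup_add_biSup_le' (p := fun V : Opens X => closure (V : Set X) ⊆ U)
    (q := fun V : Opens X => closure (V : Set X) ⊆ U') ⟨⊥, by simp⟩ ⟨⊥, by simp⟩ fun V hV V' hV' => ?_
  have hd : Disjoint V V' := by
    rw [← Opens.coe_disjoint]
    exact h.mono (subset_closure.trans hV) (subset_closure.trans hV')
  refine (hsuper V V' hd).trans (le_iSup₂_of_le (V ⊔ V') ?_ le_rfl)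
  rw [Opens.coe_sup, closure_union]
  exact Set.union_subset_union hV hV'

theorem innerReg_smul_le [ContinuousConstSMul G X] {D : Opens X → ℝ≥0∞}
    (hinv : ∀ (g : G) (U V : Opens X), (V : Set X) = g • (U : Set X) → D V ≤ D U) (g : G)
    (U : Set X) : innerReg D (g • U) ≤ innerReg D U := by
  refine iSup₂_le fun V hV => ?_
  let W : Opens X := ⟨g⁻¹ • (V : Set X), V.isOpen.smul _⟩
  refine (hinv g W V (smul_inv_smul g (V : Set X)).symm).trans (le_iSup₂_of_le W ?_ le_rfl)
  change closure (g⁻¹ • (V : Set X)) ⊆ U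
  rwa [closure_smul, ← Set.subset_smul_set_iff]

/-- A monotone, subadditive, invariant set function on open sets which is superadditive on disjoint
sets regularizes to an invariant outer regular Borel measure. -/
theorem exists_invariant_outerRegular_measure [CompactSpace X] [MetrizableSpace X]
    [ContinuousConstSMul G X] [MeasurableSpace X] [BorelSpace X] {D : Opens X → ℝ≥0∞}
    (h0 : D ⊥ = 0) (hmono : Monotone D) (hsub : ∀ U V, D (U ⊔ V) ≤ D U + D V)
    (hsuper : ∀ U V, Disjoint U V → D U + D V ≤ D (U ⊔ V))
    (hinv : ∀ (g : G) (U V : Opens X), (V : Set X) = g • (U : Set X) → D V ≤ D U) :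
    ∃ μ : Measure X, μ.OuterRegular ∧ (∀ (g : G) (s : Set X), μ (g • s) = μ s) ∧
      ∀ U : Set X, IsOpen U → μ U = innerReg D U := by
  let _ := metrizableSpaceMetric X
  let ν : OuterMeasure X :=
    inducedOuterMeasure (fun U (_ : IsOpen U) => innerReg D U) isOpen_empty (innerReg_empty h0)
  have hU : ∀ ⦃f : ℕ → Set X⦄, (∀ i, IsOpen (f i)) → IsOpen (⋃ i, f i) := fun f hf =>
    isOpen_iUnion hf
  have hle := fun (f : ℕ → Set X) (hf : ∀ i, IsOpen (f i)) =>
    innerReg_iUnion_le h0 hmono hsub f hf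
  have hm := fun (s t : Set X) (_ : IsOpen s) (_ : IsOpen t) (h : s ⊆ t) => innerReg_mono D h
  have hν : ∀ U, IsOpen U → ν U = innerReg D U := fun U h =>
    inducedOuterMeasure_eq' hU hle hm h
  have hν' : ∀ s, ν s = ⨅ (t : Set X) (_ : IsOpen t) (_ : s ⊆ t), innerReg D t := fun s =>
    inducedOuterMeasure_eq_iInf hU hle hm s
  have hmetric : ν.IsMetric := by
    intro s t hst
    refine le_antisymm (measure_union_le s t) ?_
    rw [hν' (s ∪ t)]
    refine le_iInf₂ fun O hO => le_iInf fun hstO => ?_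
    obtain ⟨r, hr, hsep⟩ := hst
    obtain ⟨u, v, hu, hv, hsu, htv, huv⟩ : SeparatedNhds s t := by
      have hmem : ∀ (a : Set X), a ⊆ ⋃ x ∈ a, Metric.eball x (r / 2) := fun a x hx =>
        Set.mem_iUnion₂.2 ⟨x, hx, Metric.mem_eball_self (ENNReal.half_pos hr)⟩
      have hop : ∀ (a : Set X), IsOpen (⋃ x ∈ a, Metric.eball x (r / 2)) := fun a =>
        isOpen_biUnion fun x _ => Metric.isOpen_eball
      refine ⟨_, _, hop s, hop t, hmem s, hmem t, Set.disjoint_left.2 fun z hzs hzt => ?_⟩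
      obtain ⟨x, hx, hzx⟩ := Set.mem_iUnion₂.1 hzs
      obtain ⟨y, hy, hzy⟩ := Set.mem_iUnion₂.1 hzt
      refine (hsep x hx y hy).not_gt ?_
      calc edist x y ≤ edist x z + edist z y := edist_triangle _ _ _
        _ < r / 2 + r / 2 := ENNReal.add_lt_add (by rwa [edist_comm]) hzy
        _ = r := ENNReal.add_halves r
    calc ν s + ν t ≤ ν (O ∩ u) + ν (O ∩ v) :=
          add_le_add (measure_mono fun x hx => ⟨hstO (Or.inl hx), hsu hx⟩)
            (measure_mono fun x hx => ⟨hstO (Or.inr hx), htv hx⟩)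
      _ = innerReg D (O ∩ u) + innerReg D (O ∩ v) := by rw [hν _ (hO.inter hu), hν _ (hO.inter hv)]
      _ ≤ innerReg D (O ∩ u ∪ O ∩ v) :=
          innerReg_add_le hsuper (huv.mono Set.inter_subset_right Set.inter_subset_right)
      _ ≤ innerReg D O := innerReg_mono D (Set.union_subset Set.inter_subset_left
          Set.inter_subset_left)
  have hcar := hmetric.borel_le_caratheodory
  rw [← BorelSpace.measurable_eq (α := X)] at hcar
  have hopen : ∀ U, IsOpen U → ν.toMeasure hcar U = innerReg D U := fun U h => by
    rw [toMeasure_apply _ _ h.measurableSet, hν U h]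
  have hreg : (ν.toMeasure hcar).OuterRegular := by
    refine ⟨fun s hs r hr => ?_⟩
    rw [toMeasure_apply _ _ hs, gt_iff_lt, hν'] at hr
    simp only [iInf_lt_iff] at hr
    obtain ⟨t, ht, hst, htr⟩ := hr
    exact ⟨t, hst, ht, by rwa [hopen t ht]⟩
  refine ⟨ν.toMeasure hcar, hreg, ?_, hopen⟩
  have hsmul : ∀ (g : G) (s : Set X), ν.toMeasure hcar (g • s) ≤ ν.toMeasure hcar s := by
    intro g s
    rw [s.measure_eq_iInf_isOpen]
    refine le_iInf₂ fun O hsO => le_iInf fun hO => ?_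
    calc ν.toMeasure hcar (g • s) ≤ ν.toMeasure hcar (g • O) := measure_mono (Set.smul_set_mono hsO)
      _ = innerReg D (g • O) := hopen _ (hO.smul g)
      _ ≤ innerReg D O := innerReg_smul_le hinv g O
      _ = ν.toMeasure hcar O := (hopen O hO).symm
  exact fun g s => le_antisymm (hsmul g s) (by simpa using hsmul g⁻¹ (g • s))

theorem InAlg.isSigmaCompact [CompactSpace X] [MetrizableSpace X] {s : Set X} (hs : InAlg X s) :
    IsSigmaCompact s := by
  let _ := metrizableSpaceMetric X
  suffices ∀ s ∈ generateSetAlgebra {t : Set X | IsOpen t},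
      IsSigmaCompact s ∧ IsSigmaCompact sᶜ from (this s hs).1
  intro s hs
  induction hs with
  | base s h =>
    have h : IsOpen s := h
    obtain ⟨F, hF, -, hFs, -⟩ := h.exists_iUnion_isClosed
    exact ⟨⟨F, fun n => (hF n).isCompact, hFs⟩, h.isClosed_compl.isCompact.isSigmaCompact⟩
  | empty => simpa using isSigmaCompact_univ
  | compl s _ ih => exact ⟨ih.2, by simpa using ih.1⟩
  | union s t _ _ ihs iht =>
    refine ⟨?_, ?_⟩
    · rw [Set.union_eq_iUnion]
      exact isSigmaCompact_iUnion _ (by rintro (_ | _); exacts [iht.1, ihs.1])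
    · obtain ⟨K, hK, hKs⟩ := ihs.2
      obtain ⟨L, hL, hLt⟩ := iht.2
      rw [Set.compl_union, ← hKs, ← hLt, Set.iUnion_inter_iUnion]
      exact isSigmaCompact_iUnion _ fun n => isSigmaCompact_iUnion _ fun m =>
        ((hK n).inter (hL m)).isSigmaCompact

theorem IsOpen.inAlg {s : Set X} (hs : IsOpen s) : InAlg X s := .base s hs

theorem IsClosed.inAlg {s : Set X} (hs : IsClosed s) : InAlg X s :=
  compl_compl s ▸ generateSetAlgebra.compl _ hs.isOpen_compl.inAlg

theorem InAlg.measurableSet [MeasurableSpace X] [BorelSpace X] {s : Set X} (hs : InAlg X s) :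
    MeasurableSet s := by
  induction hs with
  | base s h => exact IsOpen.measurableSet h
  | empty => exact .empty
  | compl s _ ih => exact ih.compl
  | union s t _ _ ihs iht => exact ihs.union iht

theorem InAlg.smul [ContinuousConstSMul G X] (g : G) {s : Set X} (hs : InAlg X s) :
    InAlg X (g • s) := by
  induction hs with
  | base s h => exact (IsOpen.smul h g).inAlg
  | empty => simpa using isOpen_empty.inAlg
  | compl s _ ih =>
    rw [Set.smul_set_compl]
    exact .compl _ ih
  | union s t _ _ ihs iht =>
    rw [Set.smul_set_union]
    exact .union _ _ ihs iht

open Classical in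
/-- The premeasure obtained by restricting an invariant outer regular Borel measure. -/
noncomputable def InvRegPremeasure.ofMeasure [CompactSpace X] [MetrizableSpace X]
    [ContinuousConstSMul G X] [MeasurableSpace X] [BorelSpace X] (μ : Measure X)
    [μ.OuterRegular] (hμ : ∀ (g : G) (s : Set X), μ (g • s) = μ s) : InvRegPremeasure X G where
  m s := if InAlg X s then μ s else 0
  junk s hs := if_neg hs
  empty' := by simp
  countably_additive A hA hd hU := by
    simp only [if_pos hU, if_pos (hA _)]
    exact measure_iUnion hd fun n => (hA n).measurableSet
  invariant g s hs := by
    rw [if_pos hs, if_pos (hs.smul g), hμ]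
  inner_regular s hs := by
    rw [if_pos hs]
    refine le_antisymm ?_ (iSup₂_le fun F hF => ?_)
    · obtain ⟨K, hK, hKs⟩ := hs.isSigmaCompact
      rw [← hKs, measure_iUnion_eq_iSup_accumulate]
      refine iSup_le fun n => ?_
      have hc := isCompact_accumulate hK n
      refine le_iSup₂_of_le (Set.accumulate K n) ⟨hc, Set.accumulate_subset_iUnion n⟩ ?_
      rw [if_pos hc.isClosed.inAlg]
    · split_ifs
      exacts [measure_mono hF.2, zero_le]
  outer_regular s hs := by
    rw [if_pos hs]
    refine le_antisymm (le_iInf₂ fun O hO => ?_) ?_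
    · rw [if_pos hO.1.inAlg]
      exact measure_mono hO.2
    · rw [s.measure_eq_iInf_isOpen]
      refine le_iInf₂ fun O hsO => le_iInf fun hO => iInf₂_le_of_le O ⟨hO, hsO⟩ ?_
      rw [if_pos hO.inAlg]

theorem InvRegPremeasure.ofMeasure_apply [CompactSpace X] [MetrizableSpace X]
    [ContinuousConstSMul G X] [MeasurableSpace X] [BorelSpace X] (μ : Measure X)
    [μ.OuterRegular] (hμ : ∀ (g : G) (s : Set X), μ (g • s) = μ s) {U : Set X} (hU : IsOpen U) :
    (InvRegPremeasure.ofMeasure μ hμ).m U = μ U :=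
  if_pos hU.inAlg

namespace InvRegPremeasure

theorem union (μ : InvRegPremeasure X G) {s t : Set X} (hs : InAlg X s) (ht : InAlg X t)
    (h : Disjoint s t) : μ.m (s ∪ t) = μ.m s + μ.m t := by
  let A : ℕ → Set X := fun n => if n = 0 then s else if n = 1 then t else ∅
  have hA : ∀ n, InAlg X (A n) := fun n => by
    simp only [A]
    split_ifs
    exacts [hs, ht, isOpen_empty.inAlg]
  have hst : ⋃ n, A n = s ∪ t := by
    refine subset_antisymm (Set.iUnion_subset fun n => ?_) (Set.union_subset ?_ ?_)
    · simp only [A]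
      split_ifs <;> simp
    · exact Set.subset_iUnion A 0
    · exact Set.subset_iUnion A 1
  have hd : Pairwise (Function.onFun Disjoint A) := by
    intro i j hij
    simp only [Function.onFun, A]
    split_ifs <;> simp_all [h.symm]
  have := μ.countably_additive A hA hd (hst ▸ .union _ _ hs ht)
  rw [hst] at this
  rw [this, tsum_eq_sum (s := {0, 1}), Finset.sum_pair zero_ne_one]
  · rfl
  · intro n hn
    have : A n = ∅ := by
      simp only [Finset.mem_insert, Finset.mem_singleton, not_or] at hn
      simp [A, hn.1, hn.2]
    rw [this, μ.empty']

theorem mono (μ : InvRegPremeasure X G) {s t : Set X} (hs : InAlg X s) (ht : InAlg X t)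
    (h : s ⊆ t) : μ.m s ≤ μ.m t := by
  have hd : InAlg X (t \ s) := isSetAlgebra_generateSetAlgebra.sdiff_mem ht hs
  rw [← Set.union_sdiff_cancel h, μ.union hs hd disjoint_sdiff_self_right]
  exact le_self_add

theorem union_le (μ : InvRegPremeasure X G) {s t : Set X} (hs : InAlg X s) (ht : InAlg X t) :
    μ.m (s ∪ t) ≤ μ.m s + μ.m t := by
  have hd : InAlg X (t \ s) := isSetAlgebra_generateSetAlgebra.sdiff_mem ht hs
  rw [← Set.union_sdiff_self, μ.union hs hd disjoint_sdiff_self_right]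
  exact add_le_add le_rfl (μ.mono hd ht Set.sdiff_subset)

theorem biUnion_le (μ : InvRegPremeasure X G) {J : Type*} (S : Finset J) {U : J → Set X}
    (hU : ∀ j, InAlg X (U j)) : μ.m (⋃ j ∈ S, U j) ≤ ∑ j ∈ S, μ.m (U j) := by
  classical
  induction S using Finset.induction_on with
  | empty => simp [μ.empty']
  | insert a S ha ih =>
    rw [Finset.set_biUnion_insert, Finset.sum_insert ha]
    exact (μ.union_le (hU a) (isSetAlgebra_generateSetAlgebra.biUnion_mem S fun j _ => hU j)).trans
      (add_le_add le_rfl ih)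

theorem biUnion_eq (μ : InvRegPremeasure X G) {J : Type*} (S : Finset J) {U : J → Set X}
    (hU : ∀ j, InAlg X (U j)) (hd : (S : Set J).PairwiseDisjoint U) :
    μ.m (⋃ j ∈ S, U j) = ∑ j ∈ S, μ.m (U j) := by
  classical
  induction S using Finset.induction_on with
  | empty => simp [μ.empty']
  | insert a S ha ih =>
    rw [Finset.coe_insert, Set.pairwiseDisjoint_insert_of_notMem (by simpa using ha)] at hd
    rw [Finset.set_biUnion_insert, Finset.sum_insert ha, ← ih hd.1]
    exact μ.union (hU a) (isSetAlgebra_generateSetAlgebra.biUnion_mem S fun j _ => hU j)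
      (Set.disjoint_iUnion₂_right.2 hd.2)

theorem card_mul_le_card_mul [ContinuousConstSMul G X] [T2Space X] (μ : InvRegPremeasure X G)
    {ι κ : Type} [Fintype ι] [Fintype κ] {A B : Set X} (hA : IsOpen A) (hB : IsOpen B)
    (h : FamSubeq G (fun _ : ι => A) (fun _ : κ => B)) :
    Fintype.card ι * μ.m A ≤ Fintype.card κ * μ.m B := by
  classical
  rw [μ.inner_regular A hA.inAlg, ENNReal.mul_iSup]
  refine iSup_le fun F => ?_
  rw [ENNReal.mul_iSup]
  refine iSup_le fun ⟨hF, hFA⟩ => ?_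
  obtain ⟨J, _, i, U, s, k, hU, hFU, hUB, hd⟩ := h (fun _ => F) fun _ => ⟨hF.isClosed, hFA⟩
  have := Fintype.ofFinite J
  have hsU : ∀ j, InAlg X (s j • U j) := fun j => ((hU j).smul (s j)).inAlg
  calc (Fintype.card ι : ℝ≥0∞) * μ.m F = ∑ _x : ι, μ.m F := by simp
    _ ≤ ∑ x : ι, ∑ j with i j = x, μ.m (U j) := Finset.sum_le_sum fun x _ => by
        refine le_trans (μ.mono hF.isClosed.inAlg ?_ ?_) (μ.biUnion_le _ fun j => (hU j).inAlg)
        · exact (isOpen_biUnion fun j _ => hU j).inAlg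
        · simpa using hFU x
    _ = ∑ j, μ.m (U j) := Finset.sum_fiberwise _ _ _
    _ = ∑ j, μ.m (s j • U j) := Finset.sum_congr rfl fun j _ =>
        (μ.invariant (s j) (U j) (hU j).inAlg).symm
    _ = ∑ y : κ, ∑ j with k j = y, μ.m (s j • U j) := (Finset.sum_fiberwise _ _ _).symm
    _ ≤ ∑ _y : κ, μ.m B := Finset.sum_le_sum fun y _ => by
        rw [← μ.biUnion_eq _ hsU]
        · refine μ.mono ?_ hB.inAlg (Set.iUnion₂_subset fun j _ => hUB j)
          exact isSetAlgebra_generateSetAlgebra.biUnion_mem _ fun j _ => hsU j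
        · intro p hp q hq hpq
          simp only [Finset.coe_filter, Finset.mem_univ, true_and, Set.mem_ofPred_eq] at hp hq
          exact hd p q hpq (hp.trans hq.symm)
    _ = Fintype.card κ * μ.m B := by simp

end InvRegPremeasure

end Measure

section Comparison

open TopologicalSpace MeasureTheory

theorem subset_iUnion_smul_of_famSubeq [T1Space X] {ι κ : Type} [Nonempty ι] {A B : Set X}
    (h : FamSubeq G (fun _ : ι => A) (fun _ : κ => B)) : A ⊆ ⋃ g : G, g • B := by
  intro x hx
  obtain ⟨J, -, i, U, s, k, -, hFU, hUB, -⟩ := h (fun _ => {x}) fun _ =>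
    ⟨isClosed_singleton, Set.singleton_subset_iff.2 hx⟩
  obtain ⟨j, -, hj⟩ := Set.mem_iUnion₂.1 (hFU (Classical.arbitrary ι) rfl)
  exact Set.mem_iUnion.2 ⟨(s j)⁻¹, Set.mem_inv_smul_set_iff.2 (hUB j (Set.smul_mem_smul_set hj))⟩

theorem famSubeq_singleton_of_subset_biUnion_smul [ContinuousConstSMul G X] {A B : Set X}
    (hB : IsOpen B) (t : Finset G) (h : A ⊆ ⋃ g ∈ t, g • B) :
    FamSubeq G (fun _ : Fin 1 => A) (fun _ : Fin t.card => B) := by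
  intro F hF
  let e := t.equivFin.symm
  refine ⟨Fin t.card, inferInstance, fun _ => 0, fun j => (e j : G) • B, fun j => (e j : G)⁻¹, id,
    fun j => hB.smul _, fun x y hy => ?_, fun j => by simp, fun p q hpq hk => absurd hk hpq⟩
  obtain ⟨g, hg, hgy⟩ := Set.mem_iUnion₂.1 (h ((hF x).2 hy))
  exact Set.mem_iUnion₂.2 ⟨t.equivFin ⟨g, hg⟩, Subsingleton.elim _ _, by simpa [e] using hgy⟩

theorem exists_invRegPremeasure [CompactSpace X] [MetrizableSpace X] [ContinuousConstSMul G X]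
    {A B V : Opens X} (hV : closure (V : Set X) ⊆ A) (hAB : (A : Set X) ⊆ ⋃ g : G, g • (B : Set X))
    (h : ∀ n : ℕ, 0 < n →
      ¬ SetSubeq G (List.replicate (n + 1) (V : Set X)) (List.replicate n (B : Set X))) :
    ∃ μ : InvRegPremeasure X G, μ.m B = 1 ∧ 1 ≤ μ.m A := by
  obtain ⟨t, ht⟩ := isClosed_closure.isCompact.elim_finite_subcover
    (fun g : G => g • (B : Set X)) (fun g => B.isOpen.smul g) (hV.trans hAB)
  obtain ⟨f, hf, hfB, hfV⟩ := exists_ennreal_state OpenMultiset.zero_le'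
    (OpenMultiset.single G B) (OpenMultiset.single G V) ⟨t.card, by
      rw [← one_nsmul (OpenMultiset.single G V), OpenMultiset.nsmul_single_le_iff]
      exact famSubeq_singleton_of_subset_biUnion_smul B.isOpen t (subset_closure.trans ht)⟩
    (fun n hn => by
      rw [OpenMultiset.nsmul_single_le_iff, ← setSubeq_replicate_iff]
      exact h n hn)
  let D : Opens X → ℝ≥0∞ := fun U => f (OpenMultiset.single G U)
  borelize X
  obtain ⟨μ, hreg, hinv, hμ⟩ := exists_invariant_outerRegular_measure (G := G) (D := D)
    (le_antisymm ((hf OpenMultiset.single_bot_le).trans_eq (map_zero f)) zero_le)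
    (hf.comp OpenMultiset.single_mono)
    (fun U W => (hf (OpenMultiset.single_sup_le U W)).trans_eq (map_add f _ _))
    (fun U W hUW => (map_add f _ _).symm.trans_le (hf (OpenMultiset.single_add_le hUW)))
    (fun g U W hUW => hf (OpenMultiset.single_le_of_eq_smul hUW))
  have hle : ∀ {W : Set X}, IsOpen W → closure (V : Set X) ⊆ W → 1 ≤ μ W := fun hW hVW =>
    hfV.trans ((le_iSup₂_of_le V hVW le_rfl).trans_eq (hμ _ hW).symm)
  have hB1 : μ B ≤ 1 := by
    rw [hμ B B.isOpen, ← hfB]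
    exact iSup₂_le fun W hW =>
      hf (OpenMultiset.single_mono (subset_closure.trans hW))
  have hB0 : μ B ≠ 0 := by
    intro h0
    have : μ (⋃ g ∈ (t : Set G), g • (B : Set X)) = 0 :=
      (measure_biUnion_null_iff t.countable_toSet).2 fun g _ => by rw [hinv, h0]
    have h1 := hle (isOpen_biUnion fun g _ => B.isOpen.smul g) ht
    rw [this] at h1
    exact absurd h1 (by simp)
  have hBtop : μ B ≠ ∞ := (hB1.trans_lt ENNReal.one_lt_top).ne
  have : ((μ B)⁻¹ • μ).OuterRegular := .smul μ (ENNReal.inv_ne_top.2 hB0)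
  refine ⟨.ofMeasure ((μ B)⁻¹ • μ) fun g s => by simp [hinv], ?_, ?_⟩
  · rw [InvRegPremeasure.ofMeasure_apply _ _ B.isOpen, Measure.smul_apply, smul_eq_mul,
      ENNReal.inv_mul_cancel hB0 hBtop]
  · rw [InvRegPremeasure.ofMeasure_apply _ _ A.isOpen, Measure.smul_apply, smul_eq_mul]
    exact one_le_mul (ENNReal.one_le_inv.2 hB1) (hle A.isOpen hV)

end Comparison

/-- **Theorem B (Corollary 3.11).** The following are equivalent:
(i) for any non-empty open sets `A, B`, if `(n+1)A ≺ nB` for some `n ∈ ℕ⁺` then `A ≺ B`;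
(ii) the action has (generalized) dynamical comparison: whenever `A, B` are open with
`A ⊆ G ⋅ B` and `μ(A) < 1` for every `μ ∈ Pr_G(X)` with `μ(B) = 1`, then `A ≺ B`. -/
theorem generalized_dynamical_comparison_iff {X : Type*} [TopologicalSpace X]
    [CompactSpace X] [T2Space X] [TopologicalSpace.MetrizableSpace X]
    {G : Type*} [Group G] [MulAction G X]
    (hG : ∀ g : G, Continuous fun x : X => g • x) :
    (∀ A B : Set X, IsOpen A → IsOpen B → A.Nonempty → B.Nonempty →
      (∃ n : ℕ, 0 < n ∧ SetSubeq G (List.replicate (n + 1) A) (List.replicate n B)) →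
      SetSubeq G [A] [B]) ↔
    (∀ A B : Set X, IsOpen A → IsOpen B →
      (A ⊆ ⋃ g : G, g • B) →
      (∀ μ : InvRegPremeasure X G, μ.m B = 1 → μ.m A < 1) →
      SetSubeq G [A] [B]) := by
  have : ContinuousConstSMul G X := ⟨hG⟩
  constructor
  · intro h A B hA hB hAB hμ F hF
    obtain ⟨V, hV, hFV, hVA⟩ := normal_exists_closure_subset (hF 0).1 hA (hF 0).2
    have hVA' : V ⊆ A := subset_closure.trans hVA
    rcases V.eq_empty_or_nonempty with rfl | hVne
    · refine ⟨fun _ => 0, fun _ => nofun, fun _ => nofun, fun _ => nofun, fun _ => nofun, fun i => ?_,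
        fun _ => nofun, fun p => nofun⟩
      obtain rfl : i = 0 := Subsingleton.elim (α := Fin 1) i 0
      exact hFV.trans (Set.empty_subset _)
    · have hBne : B.Nonempty := by
        obtain ⟨x, hx⟩ := hVne
        obtain ⟨g, b, hb, -⟩ := Set.mem_iUnion.1 (hAB (hVA' hx))
        exact ⟨b, hb⟩
      refine h V B hV hB hVne hBne ?_ F fun i => ⟨(hF i).1, ?_⟩
      · by_contra! hn
        obtain ⟨μ, hμB, hμA⟩ := exists_invRegPremeasure (A := ⟨A, hA⟩) (B := ⟨B, hB⟩)
          (V := ⟨V, hV⟩) hVA hAB hn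
        exact (hμ μ hμB).not_ge hμA
      · obtain rfl : i = 0 := Subsingleton.elim (α := Fin 1) i 0
        exact hFV
  · intro h A B hA hB hAne hBne ⟨n, hn, hsub⟩
    rw [setSubeq_replicate_iff] at hsub
    refine h A B hA hB (subset_iUnion_smul_of_famSubeq hsub) fun μ hμ => ?_
    have hle := μ.card_mul_le_card_mul hA hB hsub
    rw [hμ, Fintype.card_fin, Fintype.card_fin, mul_one] at hle
    by_contra! h1
    have : ((n + 1 : ℕ) : ℝ≥0∞) ≤ n := (le_mul_of_one_le_right' h1).trans hle
    exact absurd (Nat.cast_le.1 this) (by omega)
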